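/- arXiv:1910.04830 — 2 statements merged into one kernel-verified Lean document; each statement's English description precedes it below -/
import Mathlib

section
/- Let A, B ∈ ℂ with A ≠ 0, 1 ≤ |A|, and |A| ≤ |B| − 1, and let b(z) = A·z/(z + B) for z in the open unit disk 𝔻 (note z + B ≠ 0 on 𝔻 since |B| > 1). Then b is a nonconstant element of H∞₁ and H(b) has the complete Nevanlinna–Pick property. -/
open Complex Set Filter MeasureTheory

noncomputable section

/-- The open unit disk in `ℂ`. -/
def unitDisk : Set ℂ := Metric.ball 0 1

/-- `K` is a positive kernel on the unit disk: it is Hermitian symmetric and all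
finite Gram-type sums are (real and) nonnegative. -/
def IsPosKernel (K : ℂ → ℂ → ℂ) : Prop :=
  (∀ z ∈ unitDisk, ∀ w ∈ unitDisk, K z w = starRingEnd ℂ (K w z)) ∧
  ∀ (n : ℕ) (lam : Fin n → ℂ), (∀ i, lam i ∈ unitDisk) →
    ∀ c : Fin n → ℂ,
      0 ≤ (∑ i, ∑ j, c i * starRingEnd ℂ (c j) * K (lam i) (lam j)).re

/-- `b` belongs to the closed unit ball `H∞₁` of bounded holomorphic functions on
the unit disk. -/
def MemBallHinf (b : ℂ → ℂ) : Prop :=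
  DifferentiableOn ℂ b unitDisk ∧ ∀ z ∈ unitDisk, ‖b z‖ ≤ 1

/-- `b` is nonconstant on the unit disk. -/
def NonconstOnDisk (b : ℂ → ℂ) : Prop :=
  ∃ z ∈ unitDisk, ∃ w ∈ unitDisk, b z ≠ b w

/-- The de Branges–Rovnyak kernel `k^b(z,w) = (1 - conj (b w) * b z) / (1 - conj w * z)`. -/
def dbrKernel (b : ℂ → ℂ) (z w : ℂ) : ℂ :=
  (1 - starRingEnd ℂ (b w) * b z) / (1 - starRingEnd ℂ w * z)

/-- The de Branges–Rovnyak space `H(b)` has the complete Nevanlinna–Pick property: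
`k^b` never vanishes on `𝔻 × 𝔻` and
`(z,w) ↦ 1 - k^b(z,0) k^b(0,w) / (k^b(0,0) k^b(z,w))` is a positive kernel. -/
def HasCNP (b : ℂ → ℂ) : Prop :=
  (∀ z ∈ unitDisk, ∀ w ∈ unitDisk, dbrKernel b z w ≠ 0) ∧
  IsPosKernel (fun z w =>
    1 - dbrKernel b z 0 * dbrKernel b 0 w / (dbrKernel b 0 0 * dbrKernel b z w))

/-- `f` belongs to the Hardy space `H²` with Taylor coefficient sequence `a`:
`f z = ∑ₙ a n * zⁿ` on the unit disk and `∑ₙ ‖a n‖² < ∞`. -/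
def MemH2 (f : ℂ → ℂ) (a : ℕ → ℂ) : Prop :=
  (∀ z ∈ unitDisk, HasSum (fun n => a n * z ^ n) (f z)) ∧
  Summable (fun n => ‖a n‖ ^ 2)

theorem szego_gram_nonneg {n : ℕ} (x d : Fin n → ℂ) (hx : ∀ i, ‖x i‖ < 1) :
    0 ≤ (∑ i, ∑ j, d i * starRingEnd ℂ (d j) / (1 - x i * starRingEnd ℂ (x j))).re := by
  have hs : HasSum (fun m : ℕ => ∑ i, ∑ j,
      d i * starRingEnd ℂ (d j) * (x i * starRingEnd ℂ (x j)) ^ m)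
      (∑ i, ∑ j, d i * starRingEnd ℂ (d j) / (1 - x i * starRingEnd ℂ (x j))) := by
    refine hasSum_sum fun i _ => hasSum_sum fun j _ => ?_
    rw [div_eq_mul_inv]
    have hij : ‖x i * starRingEnd ℂ (x j)‖ < 1 := by
      rw [norm_mul, RCLike.norm_conj]
      exact mul_lt_one_of_nonneg_of_lt_one_left (norm_nonneg _) (hx i) (hx j).le
    exact (hasSum_geometric_of_norm_lt_one hij).mul_left _
  refine (Complex.hasSum_re hs).nonneg fun m => ?_
  have : ∑ i, ∑ j, d i * starRingEnd ℂ (d j) * (x i * starRingEnd ℂ (x j)) ^ m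
      = (∑ i, d i * x i ^ m) * starRingEnd ℂ (∑ i, d i * x i ^ m) := by
    rw [map_sum, Finset.sum_mul_sum]
    refine Finset.sum_congr rfl fun i _ => Finset.sum_congr rfl fun j _ => ?_
    simp only [map_mul, map_pow]
    ring
  rw [this, Complex.mul_conj, Complex.ofReal_re]
  exact Complex.normSq_nonneg _

/-- The complete Pick kernel of a Möbius map, expanded as a sum of positive kernels. -/
theorem moebius_pick_identity {z w B C s : ℂ} (hB : B ≠ 0) (hC : C ≠ 0)
    (hz : z + B ≠ 0) (hw : w + C ≠ 0)
    (h : 1 - s * z / (z + B) * (s * w / (w + C)) ≠ 0) :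
    1 - (1 - w * z) / (1 - s * z / (z + B) * (s * w / (w + C))) =
      (s + 1) / (B * C) * (z * w / (1 - 0 * 0)) +
      (1 - (s + 1) ^ 2 / (B * C)) *
        (z * w / (1 - s * z / (z + B) * (s * w / (w + C)))) +
      s / (B * C) * (z * (1 + s * z / (z + B)) * (w * (1 + s * w / (w + C))) /
        (1 - s * z / (z + B) * (s * w / (w + C)))) := by
  have h' : (z + B) * (w + C) - s * z * (s * w) ≠ 0 := by
    intro h0
    apply h
    field_simp
    linear_combination h0
  have e : 1 - s * z / (z + B) * (s * w / (w + C)) =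
      ((z + B) * (w + C) - s * z * (s * w)) / ((z + B) * (w + C)) := by
    field_simp
  rw [e]
  generalize hD : (z + B) * (w + C) - s * z * (s * w) = D at h'
  field_simp
  rw [← hD]
  ring

theorem norm_sub_one_lt_norm_add_of_mem_unitDisk {B z : ℂ} (hz : z ∈ unitDisk) :
    ‖B‖ - 1 < ‖z + B‖ := by
  have hz1 : ‖z‖ < 1 := by simpa [unitDisk] using hz
  have := norm_sub_le (z + B) z
  rw [add_sub_cancel_left] at this
  linarith

theorem norm_moebius_lt_one {A B z : ℂ} (hA : A ≠ 0) (hAB : ‖A‖ ≤ ‖B‖ - 1)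
    (hz : z ∈ unitDisk) : ‖A * z / (z + B)‖ < 1 := by
  have hA0 := norm_pos_iff.2 hA
  have hz1 : ‖z‖ < 1 := by simpa [unitDisk] using hz
  have h := norm_sub_one_lt_norm_add_of_mem_unitDisk (B := B) hz
  rw [norm_div, norm_mul, div_lt_one (by linarith)]
  nlinarith

/-- for `A ≠ 0` with `1 ≤ |A|` and `|A| ≤ |B| - 1`, the function
`b z = A z/(z + B)` is a nonconstant element of `H∞₁` and `H(b)` has the complete
Nevanlinna–Pick property. -/
theorem moebius_CNP (A B : ℂ) (hA : A ≠ 0) (hA1 : 1 ≤ ‖A‖)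
    (hAB : ‖A‖ ≤ ‖B‖ - 1) :
    MemBallHinf (fun z => A * z / (z + B)) ∧
      NonconstOnDisk (fun z => A * z / (z + B)) ∧
      HasCNP (fun z => A * z / (z + B)) := by
  have hA0 := norm_pos_iff.2 hA
  have hB0 : B ≠ 0 := norm_pos_iff.1 (by linarith)
  have hne : ∀ z ∈ unitDisk, z + B ≠ 0 := fun z hz =>
    norm_pos_iff.1 (by linarith [norm_sub_one_lt_norm_add_of_mem_unitDisk (B := B) hz])
  have hb : ∀ z ∈ unitDisk, ‖A * z / (z + B)‖ < 1 := fun z hz =>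
    norm_moebius_lt_one hA hAB hz
  have hden : ∀ a b : ℂ, ‖a‖ < 1 → ‖b‖ < 1 → 1 - a * b ≠ 0 := by
    intro a b ha hb h
    have h1 : ‖a * b‖ < 1 := by
      rw [norm_mul]
      exact mul_lt_one_of_nonneg_of_lt_one_left (norm_nonneg _) ha hb.le
    rw [← sub_eq_zero.1 h] at h1
    simp at h1
  have hdisk : ∀ z ∈ unitDisk, ‖z‖ < 1 := fun z hz => by simpa [unitDisk] using hz
  refine ⟨⟨?_, fun z hz => (hb z hz).le⟩, ?_, ?_, ?_, ?_⟩
  · exact DifferentiableOn.div (by fun_prop) (by fun_prop) hne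
  · have hm : (1 / 2 : ℂ) ∈ unitDisk := by
      simp [unitDisk]
      norm_num
    refine ⟨1 / 2, hm, 0, by simp [unitDisk], ?_⟩
    have := hne _ hm
    simp only [mul_zero, zero_div]
    exact div_ne_zero (mul_ne_zero hA (by norm_num)) this
  · intro z hz w hw
    refine div_ne_zero (hden _ _ ?_ (hb z hz)) (hden _ _ ?_ (hdisk z hz))
    · rw [RCLike.norm_conj]
      exact hb w hw
    · rw [RCLike.norm_conj]
      exact hdisk w hw
  · intro z _ w _
    simp only [dbrKernel, map_sub, map_mul, map_div₀, map_one, map_add, Complex.conj_conj,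
      map_zero]
    ring
  · intro n lam hlam c
    set s : ℝ := ‖A‖ with hs
    set x : Fin n → ℂ := fun i => s * lam i / (lam i + B) with hx
    have hx1 : ∀ i, ‖x i‖ < 1 := fun i => by
      have := hb _ (hlam i)
      simpa [hx, hs, norm_mul, norm_div] using this
    have hAA : A * starRingEnd ℂ A = (s : ℂ) * s := by
      rw [Complex.mul_conj, Complex.normSq_eq_norm_sq]
      push_cast
      ring
    have hBB : B * starRingEnd ℂ B = ((‖B‖ ^ 2 : ℝ) : ℂ) := by
      rw [Complex.mul_conj, Complex.normSq_eq_norm_sq]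
    let G : (Fin n → ℂ) → (Fin n → ℂ) → ℂ := fun y d =>
      ∑ i, ∑ j, d i * starRingEnd ℂ (d j) / (1 - y i * starRingEnd ℂ (y j))
    have key : ∑ i, ∑ j, c i * starRingEnd ℂ (c j) *
        (1 - dbrKernel (fun z => A * z / (z + B)) (lam i) 0 *
          dbrKernel (fun z => A * z / (z + B)) 0 (lam j) /
          (dbrKernel (fun z => A * z / (z + B)) 0 0 *
            dbrKernel (fun z => A * z / (z + B)) (lam i) (lam j))) =
        (((s + 1) / ‖B‖ ^ 2 : ℝ) : ℂ) * G (fun _ => 0) (fun i => c i * lam i) +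
        ((1 - (s + 1) ^ 2 / ‖B‖ ^ 2 : ℝ) : ℂ) * G x (fun i => c i * lam i) +
        ((s / ‖B‖ ^ 2 : ℝ) : ℂ) * G x (fun i => c i * (lam i * (1 + x i))) := by
      simp only [G, Finset.mul_sum, ← Finset.sum_add_distrib]
      refine Finset.sum_congr rfl fun i _ => Finset.sum_congr rfl fun j _ => ?_
      have hxj : starRingEnd ℂ (x j) =
          s * starRingEnd ℂ (lam j) / (starRingEnd ℂ (lam j) + starRingEnd ℂ B) := by
        simp [hx]
      have hw : starRingEnd ℂ (lam j) + starRingEnd ℂ B ≠ 0 := by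
        rw [← map_add]
        exact (map_ne_zero _).2 (hne _ (hlam j))
      have hd := hden (x i) (starRingEnd ℂ (x j)) (hx1 i) (by
        rw [RCLike.norm_conj]
        exact hx1 j)
      rw [hxj] at hd
      have id := moebius_pick_identity hB0 ((map_ne_zero (starRingEnd ℂ)).2 hB0)
        (hne _ (hlam i)) hw hd
      have hbb : starRingEnd ℂ (A * lam j / (lam j + B)) * (A * lam i / (lam i + B)) =
          s * lam i / (lam i + B) *
            (s * starRingEnd ℂ (lam j) / (starRingEnd ℂ (lam j) + starRingEnd ℂ B)) := by
        simp only [map_div₀, map_mul, map_add, div_mul_div_comm]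
        congr 1
        · linear_combination (lam i * starRingEnd ℂ (lam j)) * hAA
        · ring
      have hK : 1 - dbrKernel (fun z => A * z / (z + B)) (lam i) 0 *
          dbrKernel (fun z => A * z / (z + B)) 0 (lam j) /
          (dbrKernel (fun z => A * z / (z + B)) 0 0 *
            dbrKernel (fun z => A * z / (z + B)) (lam i) (lam j)) =
          1 - (1 - starRingEnd ℂ (lam j) * lam i) / (1 - s * lam i / (lam i + B) *
            (s * starRingEnd ℂ (lam j) / (starRingEnd ℂ (lam j) + starRingEnd ℂ B))) := by
        simp only [dbrKernel, hbb]
        simp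
      rw [hK, id, hBB]
      simp only [map_mul, map_add, map_one, map_zero, hxj]
      push_cast
      simp only [hx]
      ring
    rw [key]
    simp only [Complex.add_re, Complex.re_ofReal_mul]
    have h0 : 0 < ‖B‖ ^ 2 := by positivity
    have h1 : (s + 1) ^ 2 / ‖B‖ ^ 2 ≤ 1 := by
      rw [div_le_one h0]
      gcongr
      linarith
    have hG : ∀ y d, (∀ i, ‖y i‖ < 1) → 0 ≤ (G y d).re := fun y d hy =>
      szego_gram_nonneg y d hy
    have g1 := hG (fun _ => 0) (fun i => c i * lam i) (by simp)
    have g2 := hG x (fun i => c i * lam i) hx1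
    have g3 := hG x (fun i => c i * (lam i * (1 + x i))) hx1
    have h2 := sub_nonneg.2 h1
    positivity
end
end

section
/- Let b be an element of the closed unit ball H∞₁ of the bounded holomorphic functions on the open unit disk 𝔻. Then the de Branges–Rovnyak kernel k^b(z,w) = (1 − conj(b(w))·b(z))/(1 − conj(w)·z) is a positive kernel on 𝔻; moreover, if b is nonconstant then k^b(z,w) ≠ 0 for all z, w ∈ 𝔻. -/
open Complex Set Filter MeasureTheory

noncomputable section

lemma one_sub_conj_mul_ne_zero {z w : ℂ} (h : ‖w‖ * ‖z‖ < 1) :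
    1 - starRingEnd ℂ w * z ≠ 0 := by
  intro h0
  have h1 : ‖starRingEnd ℂ w * z‖ = 1 := by rw [← sub_eq_zero.mp h0, norm_one]
  rw [norm_mul, RCLike.norm_conj] at h1
  exact h.ne h1

/-- The linear combination `∑ i, a i * k(·, lam i)` of Szegő kernels. -/
def szegoComb {n : ℕ} (a lam : Fin n → ℂ) (z : ℂ) : ℂ :=
  ∑ i, a i * (1 - starRingEnd ℂ (lam i) * z)⁻¹

lemma diffContOnCl_szegoComb {n : ℕ} {lam : Fin n → ℂ} (hlam : ∀ i, lam i ∈ unitDisk)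
    (a : Fin n → ℂ) : DiffContOnCl ℂ (szegoComb a lam) (Metric.ball 0 1) := by
  refine DifferentiableOn.diffContOnCl fun z hz => ?_
  rw [closure_ball _ one_ne_zero, mem_closedBall_zero_iff] at hz
  refine DifferentiableAt.differentiableWithinAt ?_
  unfold szegoComb
  refine DifferentiableAt.fun_sum fun i _ => ?_
  have hi : ‖lam i‖ < 1 := mem_ball_zero_iff.mp (hlam i)
  have : 1 - starRingEnd ℂ (lam i) * z ≠ 0 :=
    one_sub_conj_mul_ne_zero (by nlinarith [norm_nonneg (lam i), norm_nonneg z])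
  fun_prop (disch := assumption)

lemma circleIntegrable_mul_conj {h g : ℂ → ℂ} (hh : DiffContOnCl ℂ h (Metric.ball 0 1))
    (hg : DiffContOnCl ℂ g (Metric.ball 0 1)) :
    CircleIntegrable (fun z => h z * starRingEnd ℂ (g z)) 0 1 := by
  refine ContinuousOn.circleIntegrable zero_le_one ?_
  have hs : Metric.sphere (0 : ℂ) 1 ⊆ Metric.closedBall 0 1 := Metric.sphere_subset_closedBall
  exact (hh.continuousOn_ball.mono hs).mul
    (Complex.continuous_conj.comp_continuousOn (hg.continuousOn_ball.mono hs))

/-- The reproducing property of the Szegő kernel. -/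
lemma circleAverage_mul_conj_szego {h : ℂ → ℂ} (hh : DiffContOnCl ℂ h (Metric.ball 0 1))
    {w : ℂ} (hw : w ∈ unitDisk) :
    Real.circleAverage (fun z => h z * starRingEnd ℂ (1 - starRingEnd ℂ w * z)⁻¹) 0 1 = h w := by
  rw [← DiffContOnCl.circleAverage_smul_div (c := 0) (R := 1) (f := h) (w := w)
    (by simpa using hh) (by simpa [unitDisk] using hw)]
  refine Real.circleAverage_congr_sphere fun z hz => ?_
  have hz1 : ‖z‖ = 1 := by simpa using hz
  have hz0 : z ≠ 0 := by rintro rfl; simp at hz1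
  have hzc : starRingEnd ℂ z = z⁻¹ := (Complex.inv_eq_conj hz1).symm
  have hzw : z - w ≠ 0 := by
    intro h0
    have hw1 : ‖w‖ < 1 := mem_ball_zero_iff.mp hw
    rw [← sub_eq_zero.mp h0, hz1] at hw1
    exact lt_irrefl _ hw1
  have key : 1 - w * z⁻¹ = (z - w) / z := by field_simp
  simp only [map_inv₀, map_sub, map_one, map_mul, Complex.conj_conj, hzc, key, inv_div, sub_zero,
    smul_eq_mul]
  ring

lemma circleAverage_mul_conj_szegoComb {h : ℂ → ℂ} (hh : DiffContOnCl ℂ h (Metric.ball 0 1))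
    {n : ℕ} {lam : Fin n → ℂ} (hlam : ∀ i, lam i ∈ unitDisk) (a : Fin n → ℂ) :
    Real.circleAverage (fun z => h z * starRingEnd ℂ (szegoComb a lam z)) 0 1 =
      ∑ i, starRingEnd ℂ (a i) * h (lam i) := by
  have hint (i : Fin n) : CircleIntegrable
      (fun z => starRingEnd ℂ (a i) *
        (h z * starRingEnd ℂ (1 - starRingEnd ℂ (lam i) * z)⁻¹)) 0 1 := by
    have := circleIntegrable_mul_conj hh (diffContOnCl_szegoComb (fun _ : Fin 1 => hlam i) 1)
    refine CircleIntegrable.const_smul (a := starRingEnd ℂ (a i))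
      (f := fun z => h z * starRingEnd ℂ (1 - starRingEnd ℂ (lam i) * z)⁻¹) ?_
    simpa [szegoComb] using this
  calc
    _ = Real.circleAverage (fun z => ∑ i, starRingEnd ℂ (a i) *
        (h z * starRingEnd ℂ (1 - starRingEnd ℂ (lam i) * z)⁻¹)) 0 1 := by
      congr 1
      ext z
      rw [szegoComb, map_sum, Finset.mul_sum]
      refine Finset.sum_congr rfl fun i _ => ?_
      rw [map_mul]
      ring
    _ = _ := by
      rw [Real.circleAverage_fun_sum fun i _ => hint i]
      refine Finset.sum_congr rfl fun i _ => ?_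
      have := Real.circleAverage_fun_smul (a := starRingEnd ℂ (a i)) (c := 0) (R := 1)
        (f := fun z => h z * starRingEnd ℂ (1 - starRingEnd ℂ (lam i) * z)⁻¹)
      simp only [smul_eq_mul] at this
      rw [this, circleAverage_mul_conj_szego hh (hlam i)]

/-- Positivity of the de Branges–Rovnyak kernel when `b` is continuous up to the boundary. -/
lemma dbrKernel_sum_re_nonneg_of_diffContOnCl {b : ℂ → ℂ}
    (hb : DiffContOnCl ℂ b (Metric.ball 0 1)) (hb1 : ∀ z ∈ Metric.sphere (0 : ℂ) 1, ‖b z‖ ≤ 1)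
    {n : ℕ} {lam : Fin n → ℂ} (hlam : ∀ i, lam i ∈ unitDisk) (c : Fin n → ℂ) :
    0 ≤ (∑ i, ∑ j, c i * starRingEnd ℂ (c j) * dbrKernel b (lam i) (lam j)).re := by
  set f := szegoComb (fun i => starRingEnd ℂ (c i)) lam with hf
  set g := szegoComb (fun i => starRingEnd ℂ (c i * b (lam i))) lam with hg
  have hfd : DiffContOnCl ℂ f (Metric.ball 0 1) := diffContOnCl_szegoComb hlam _
  have hgd : DiffContOnCl ℂ g (Metric.ball 0 1) := diffContOnCl_szegoComb hlam _
  have hbgd : DiffContOnCl ℂ (fun z => b z * g z) (Metric.ball 0 1) := hb.smul hgd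
  have hud : DiffContOnCl ℂ (fun z => f z - (2 : ℂ) * (b z * g z)) (Metric.ball 0 1) :=
    hfd.sub (hbgd.const_smul (2 : ℂ))
  have h1 := circleIntegrable_mul_conj hud hfd
  have h2 := circleIntegrable_mul_conj hgd hgd
  have hsum : ∑ i, ∑ j, c i * starRingEnd ℂ (c j) * dbrKernel b (lam i) (lam j) =
      Real.circleAverage (fun z => (f z - 2 * (b z * g z)) * starRingEnd ℂ (f z) +
        g z * starRingEnd ℂ (g z)) 0 1 := by
    rw [Real.circleAverage_fun_add h1 h2, circleAverage_mul_conj_szegoComb hud hlam,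
      circleAverage_mul_conj_szegoComb hgd hlam, ← Finset.sum_add_distrib]
    refine Finset.sum_congr rfl fun i _ => ?_
    simp only [Complex.conj_conj]
    calc
      _ = c i * f (lam i) - c i * b (lam i) * g (lam i) := by
        rw [hf, hg, szegoComb, szegoComb, Finset.mul_sum, Finset.mul_sum,
          ← Finset.sum_sub_distrib]
        refine Finset.sum_congr rfl fun j _ => ?_
        rw [dbrKernel, map_mul]
        ring
      _ = _ := by ring
  rw [hsum]
  have hre := Complex.reCLM.circleAverage_comp_comm (h1.add h2)
  rw [Complex.reCLM_apply] at hre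
  refine le_of_le_of_eq (Real.circleAverage_nonneg_of_nonneg fun z hz => ?_) hre
  have hbz : ‖b z‖ ^ 2 ≤ 1 := pow_le_one₀ (norm_nonneg _) (hb1 z (by simpa using hz))
  have h3 := mul_nonneg (sub_nonneg.mpr hbz) (sq_nonneg ‖g z‖)
  have h4 := sq_nonneg ‖f z - b z * g z‖
  simp only [Complex.sq_norm, Complex.normSq_apply] at h3 h4
  simp only [Function.comp_apply, Pi.add_apply, Complex.reCLM_apply, Complex.add_re,
    Complex.mul_re, Complex.mul_im, Complex.sub_re, Complex.sub_im, Complex.conj_re,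
    Complex.conj_im, Complex.re_ofNat, Complex.im_ofNat] at h3 h4 ⊢
  nlinarith

lemma dbrKernel_sum_re_nonneg {b : ℂ → ℂ} (hb : MemBallHinf b) {n : ℕ} {lam : Fin n → ℂ}
    (hlam : ∀ i, lam i ∈ unitDisk) (c : Fin n → ℂ) :
    0 ≤ (∑ i, ∑ j, c i * starRingEnd ℂ (c j) * dbrKernel b (lam i) (lam j)).re := by
  have hopen : IsOpen unitDisk := Metric.isOpen_ball
  have hdil {r : ℝ} (h0 : 0 < r) (h1 : r < 1) {z : ℂ} (hz : ‖z‖ ≤ 1) : (r : ℂ) * z ∈ unitDisk := by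
    rw [unitDisk, mem_ball_zero_iff, norm_mul, Complex.norm_of_nonneg h0.le]
    nlinarith [norm_nonneg z]
  have hpos : ∀ᶠ r : ℝ in nhdsWithin 1 (Iio 1),
      0 ≤ (∑ i, ∑ j, c i * starRingEnd ℂ (c j) *
        dbrKernel (fun z => b (r * z)) (lam i) (lam j)).re := by
    filter_upwards [Ioo_mem_nhdsLT (zero_lt_one' ℝ)] with r hr
    refine dbrKernel_sum_re_nonneg_of_diffContOnCl ?_ (fun z hz => ?_) hlam c
    · refine DifferentiableOn.diffContOnCl fun z hz => ?_
      rw [closure_ball _ one_ne_zero, mem_closedBall_zero_iff] at hz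
      have hd : DifferentiableAt ℂ b (r * z) :=
        hb.1.differentiableAt (hopen.mem_nhds (hdil hr.1 hr.2 hz))
      exact (hd.comp z (by fun_prop : DifferentiableAt ℂ (fun z => (r : ℂ) * z) z)
        ).differentiableWithinAt
    · exact hb.2 _ (hdil hr.1 hr.2 (mem_sphere_zero_iff_norm.mp hz).le)
  refine ge_of_tendsto ?_ hpos
  refine (Complex.continuous_re.tendsto _).comp ?_
  refine tendsto_finsetSum _ fun i _ => tendsto_finsetSum _ fun j _ => Tendsto.const_mul _ ?_
  have hlim (i : Fin n) : Tendsto (fun r : ℝ => b (r * lam i)) (nhdsWithin 1 (Iio 1))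
      (nhds (b (lam i))) := by
    have hcont : ContinuousAt b (lam i) :=
      (hb.1.differentiableAt (hopen.mem_nhds (hlam i))).continuousAt
    refine hcont.tendsto.comp (Tendsto.mono_left ?_ nhdsWithin_le_nhds)
    have : Continuous fun r : ℝ => (r : ℂ) * lam i := by fun_prop
    simpa using this.tendsto 1
  exact (tendsto_const_nhds.sub
    (((Complex.continuous_conj.tendsto _).comp (hlim j)).mul (hlim i))).div_const _

lemma norm_lt_one_of_nonconstOnDisk {b : ℂ → ℂ} (hb : MemBallHinf b) (hnc : NonconstOnDisk b)
    {z : ℂ} (hz : z ∈ unitDisk) : ‖b z‖ < 1 := by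
  refine lt_of_le_of_ne (hb.2 z hz) fun h1 => ?_
  have heq : EqOn b (Function.const ℂ (b z)) unitDisk :=
    Complex.eqOn_of_isPreconnected_of_isMaxOn_norm (convex_ball 0 1).isPreconnected
      Metric.isOpen_ball hb.1 hz fun w hw => by simpa [h1] using hb.2 w hw
  obtain ⟨u, hu, v, hv, huv⟩ := hnc
  exact huv ((heq hu).trans (heq hv).symm)

/-- for `b ∈ H∞₁`, the de Branges–Rovnyak kernel `k^b` is a positive
kernel on the unit disk; moreover if `b` is nonconstant then `k^b` never vanishes
on `𝔻 × 𝔻`. -/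
theorem dbrKernel_posKernel (b : ℂ → ℂ) (hb : MemBallHinf b) :
    IsPosKernel (dbrKernel b) ∧
      (NonconstOnDisk b →
        ∀ z ∈ unitDisk, ∀ w ∈ unitDisk, dbrKernel b z w ≠ 0) := by
  refine ⟨⟨fun z _ w _ => ?_, fun n lam hlam c => dbrKernel_sum_re_nonneg hb hlam c⟩,
    fun hnc z hz w hw => ?_⟩
  · simp only [dbrKernel, map_div₀, map_sub, map_one, map_mul, Complex.conj_conj]
    ring
  · have hz1 : ‖z‖ < 1 := mem_ball_zero_iff.mp hz
    have hw1 : ‖w‖ < 1 := mem_ball_zero_iff.mp hw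
    exact div_ne_zero
      (one_sub_conj_mul_ne_zero (mul_lt_one_of_nonneg_of_lt_one_left (norm_nonneg _)
        (norm_lt_one_of_nonconstOnDisk hb hnc hw) (norm_lt_one_of_nonconstOnDisk hb hnc hz).le))
      (one_sub_conj_mul_ne_zero (mul_lt_one_of_nonneg_of_lt_one_left (norm_nonneg _) hw1 hz1.le))
end
end
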